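/- Let p be a prime and let K be a finite extension of the field ℚ_p of p-adic numbers. Then every finite subgroup of PGL(2,K) is isomorphic, as an abstract group, to one of the following: a cyclic group of order m (for some m ≥ 1), a dihedral group D_n of order 2n (for some n ≥ 1), the alternating group A₄, the symmetric group S₄, or the alternating group A₅. -/

import Mathlib

open Matrix

/-- The projective general linear group `PGL(2,K)`: the quotient of `GL(2,K)` by its
center, the subgroup of nonzero scalar matrices. -/
abbrev PGL2 (K : Type*) [Field K] : Type _ :=
  GL (Fin 2) K ⧸ Subgroup.center (GL (Fin 2) K)

set_option linter.unusedSectionVars false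

namespace FinPGL

open MulAction

/-- A group with a cyclic index two subgroup outside of which every element is an involution is
dihedral. -/
lemma dihedral_of_index_two {G : Type*} [Group G] [Finite G] (H : Subgroup G) [IsCyclic H]
    (hi : H.index = 2) (hinv : ∀ g : G, g ∉ H → g * g = 1) :
    ∃ n : ℕ, 1 ≤ n ∧ Nonempty (G ≃* DihedralGroup n) := by
  classical
  refine ⟨Nat.card H, Nat.card_pos, ?_⟩
  have : NeZero (Nat.card H) := ⟨Nat.card_pos.ne'⟩
  obtain ⟨s, hs⟩ : ∃ s : G, s ∉ H := by
    by_contra! hcon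
    have : H = ⊤ := by ext; simp [hcon]
    rw [this] at hi; simp at hi
  let φ := zmodCyclicMulEquiv (G := H) inferInstance
  have hss : s * s = 1 := hinv s hs
  have hcomm : ∀ h ∈ H, h * s = s * h⁻¹ := by
    intro h hh
    have h1 : s * h ∉ H := fun h2 => hs ((H.mul_mem_cancel_right hh).1 h2)
    have h3 := hinv _ h1
    have hs' : s⁻¹ = s := inv_eq_of_mul_eq_one_left hss
    have : s * h = h⁻¹ * s⁻¹ := by
      rw [← _root_.mul_inv_rev]; exact eq_inv_of_mul_eq_one_left h3
    rw [hs'] at this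
    calc h * s = h * (s * h) * h⁻¹ := by group
      _ = s * h⁻¹ := by rw [this]; group
  let F : DihedralGroup (Nat.card H) → G := fun d => match d with
    | .r i => (φ (Multiplicative.ofAdd i) : G)
    | .sr i => s * (φ (Multiplicative.ofAdd i) : G)
  have Fr : ∀ i, F (.r i) = (φ (Multiplicative.ofAdd i) : G) := fun _ => rfl
  have Fs : ∀ i, F (.sr i) = s * (φ (Multiplicative.ofAdd i) : G) := fun _ => rfl
  have hadd : ∀ i j, (φ (Multiplicative.ofAdd (i + j)) : G) =
      (φ (Multiplicative.ofAdd i) : G) * (φ (Multiplicative.ofAdd j) : G) := by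
    intro i j; rw [ofAdd_add, map_mul]; rfl
  have hneg : ∀ i, (φ (Multiplicative.ofAdd (-i)) : G) = (φ (Multiplicative.ofAdd i) : G)⁻¹ := by
    intro i; rw [ofAdd_neg, map_inv]; rfl
  have hsub : ∀ i j, (φ (Multiplicative.ofAdd (j - i)) : G) =
      (φ (Multiplicative.ofAdd i) : G)⁻¹ * (φ (Multiplicative.ofAdd j) : G) := by
    intro i j; rw [sub_eq_neg_add, hadd, hneg]
  let f : DihedralGroup (Nat.card H) →* G := MonoidHom.mk' F (by
    rintro (i | i) (j | j)
    · rw [DihedralGroup.r_mul_r, Fr, Fr, Fr, hadd]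
    · rw [DihedralGroup.r_mul_sr, Fr, Fs, Fs, hsub, ← mul_assoc, ← mul_assoc,
        hcomm _ (φ _).2]
    · rw [DihedralGroup.sr_mul_r, Fs, Fs, Fr, hadd, mul_assoc]
    · rw [DihedralGroup.sr_mul_sr, Fr, Fs, Fs, hsub, mul_assoc, ← mul_assoc _ s,
        hcomm _ (φ _).2, ← mul_assoc, ← mul_assoc, hss, one_mul])
  have hinj : Function.Injective f := by
    rw [injective_iff_map_eq_one]
    rintro (i | i) hi
    · have : φ (Multiplicative.ofAdd i) = 1 := Subtype.ext hi
      rw [MulEquiv.map_eq_one_iff] at this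
      have : i = 0 := this
      rw [this]; rfl
    · exfalso
      have h1 : s * (φ (Multiplicative.ofAdd i) : G) = 1 := hi
      apply hs
      rw [eq_inv_of_mul_eq_one_left h1]
      exact H.inv_mem (φ _).2
  have hcard : Nat.card (DihedralGroup (Nat.card H)) = Nat.card G := by
    rw [DihedralGroup.nat_card, ← H.card_mul_index, hi, mul_comm]
  have hbij : Function.Bijective f :=
    (Nat.bijective_iff_injective_and_card f).2 ⟨hinj, hcard⟩
  exact ⟨(MulEquiv.ofBijective f hbij).symm⟩

lemma alternating_of_embed {G α : Type*} [Group G] [Finite G] [Finite α] (k : ℕ)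
    (hα : Nat.card α = k) (f : G →* Equiv.Perm α) (hf : Function.Injective f)
    (hG : 2 * Nat.card G = k.factorial) : Nonempty (G ≃* alternatingGroup (Fin k)) := by
  classical
  let e : α ≃ Fin k := (Finite.equivFin α).trans (finCongr hα)
  let g : G →* Equiv.Perm (Fin k) := e.permCongrHom.toMonoidHom.comp f
  have hg : Function.Injective g := e.permCongrHom.injective.comp hf
  have hr : g.range.index = 2 := by
    have h1 := g.range.card_mul_index
    have h2 : Nat.card g.range = Nat.card G :=
      (Nat.card_congr (MonoidHom.ofInjective hg).toEquiv).symm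
    rw [h2, Nat.card_perm, Nat.card_fin, ← hG, mul_comm] at h1
    exact Nat.eq_of_mul_eq_mul_right Nat.card_pos h1
  have : g.range = alternatingGroup (Fin k) := Equiv.Perm.eq_alternatingGroup_of_index_eq_two hr
  exact ⟨(MonoidHom.ofInjective hg).trans (MulEquiv.subgroupCongr this)⟩

lemma symmetric_of_embed {G α : Type*} [Group G] [Finite G] [Finite α] (k : ℕ)
    (hα : Nat.card α = k) (f : G →* Equiv.Perm α) (hf : Function.Injective f)
    (hG : Nat.card G = k.factorial) : Nonempty (G ≃* Equiv.Perm (Fin k)) := by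
  classical
  let e : α ≃ Fin k := (Finite.equivFin α).trans (finCongr hα)
  let g : G →* Equiv.Perm (Fin k) := e.permCongrHom.toMonoidHom.comp f
  have hg : Function.Injective g := e.permCongrHom.injective.comp hf
  have hbij : Function.Bijective g :=
    (Nat.bijective_iff_injective_and_card g).2 ⟨hg, by rw [hG, Nat.card_perm, Nat.card_fin]⟩
  exact ⟨MulEquiv.ofBijective g hbij⟩

section geometry

variable {G P : Type*} [Group G] [Finite G] [MulAction G P]

lemma fixed_set_eq (h2 : ∀ g : G, g ≠ 1 → (fixedBy P g).ncard = 2) {t u : G} (hu : u ≠ 1)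
    (ht : t ≠ 1) (hmem : u ∈ Subgroup.zpowers t) : fixedBy P u = fixedBy P t := by
  have hfin : (fixedBy P u).Finite := Set.finite_of_ncard_ne_zero (by rw [h2 u hu]; decide)
  refine (Set.eq_of_subset_of_ncard_le ?_ (by rw [h2 u hu, h2 t ht]) hfin).symm
  intro x hx
  obtain ⟨k, rfl⟩ := hmem
  have : t ∈ stabilizer G x := hx
  exact Subgroup.zpow_mem _ this k

lemma card_le_of_conj (h2 : ∀ g : G, g ≠ 1 → (fixedBy P g).ncard = 2) {t : G}
    (ht : t ≠ 1) (H : Subgroup G) (hH : ∀ g ∈ H, g * t * g⁻¹ ∈ Subgroup.zpowers t) {x : P}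
    (hx : x ∈ fixedBy P t) : Nat.card H ≤ 2 * Nat.card (stabilizer G x) := by
  have hfin : (fixedBy P t).Finite := Set.finite_of_ncard_ne_zero (by rw [h2 t ht]; decide)
  have hsub : orbit H x ⊆ fixedBy P t := by
    rintro _ ⟨⟨g, hg⟩, rfl⟩
    have hne : g * t * g⁻¹ ≠ 1 := by
      intro h; apply ht
      have : t = g⁻¹ * (g * t * g⁻¹) * g := by group
      rw [this, h]; group
    rw [← fixed_set_eq h2 hne ht (hH g hg)]
    change (g * t * g⁻¹) • (g • x) = g • x
    rw [smul_smul, inv_mul_cancel_right, mul_smul]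
    have : t • x = x := hx
    rw [this]
  have h1 : (orbit H x).ncard ≤ 2 := (Set.ncard_le_ncard hsub hfin).trans (h2 t ht).le
  have h3 : Nat.card H = (orbit H x).ncard * Nat.card (stabilizer H x) := by
    rw [← Nat.card_coe_set_eq, ← Nat.card_prod]
    exact (Nat.card_congr (orbitProdStabilizerEquivGroup H x)).symm
  rw [h3]
  refine Nat.mul_le_mul h1 ?_
  refine Nat.card_le_card_of_injective
    (fun h : stabilizer H x => (⟨(h.1 : G), h.2⟩ : stabilizer G x)) ?_
  intro a b hab
  apply Subtype.ext; apply Subtype.ext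
  exact congrArg (fun z : stabilizer G x => (z : G)) hab

lemma orbit_card (x : P) : (orbit G x).ncard * Nat.card (stabilizer G x) = Nat.card G := by
  rw [← Nat.card_coe_set_eq, ← Nat.card_prod]
  exact Nat.card_congr (orbitProdStabilizerEquivGroup G x)

/-- dihedral case -/
lemma dihedral_case (h2 : ∀ g : G, g ≠ 1 → (fixedBy P g).ncard = 2) (x : P)
    [IsCyclic (stabilizer G x)] (hx : 2 * Nat.card (stabilizer G x) = Nat.card G) :
    ∃ n : ℕ, 1 ≤ n ∧ Nonempty (G ≃* DihedralGroup n) := by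
  have hi : (stabilizer G x).index = 2 := by
    have := (stabilizer G x).card_mul_index
    rw [← hx, mul_comm] at this
    exact Nat.eq_of_mul_eq_mul_right Nat.card_pos this
  refine dihedral_of_index_two (stabilizer G x) hi ?_
  intro g hg
  by_contra hne
  have hg1 : g ≠ 1 := by rintro rfl; exact hg (Subgroup.one_mem _)
  have hgg : g * g ∈ stabilizer G x := Subgroup.mul_self_mem_of_index_two hi g
  have : fixedBy P (g * g) = fixedBy P g :=
    fixed_set_eq h2 hne hg1 ⟨2, zpow_two g⟩
  have hx' : x ∈ fixedBy P (g * g) := hgg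
  rw [this] at hx'
  exact hg hx'

lemma a4_case (h2 : ∀ g : G, g ≠ 1 → (fixedBy P g).ncard = 2) (x : P)
    (hx : Nat.card (stabilizer G x) = 3) (hG : Nat.card G = 12) :
    Nonempty (G ≃* alternatingGroup (Fin 4)) := by
  have ho : (orbit G x).ncard = 4 := by
    have := orbit_card (G := G) x
    rw [hx, hG] at this; omega
  have : Finite (orbit G x) := Set.finite_of_ncard_ne_zero (by rw [ho]; decide)
  refine alternating_of_embed (α := orbit G x) 4 (by rw [Nat.card_coe_set_eq, ho])
    (MulAction.toPermHom G (orbit G x)) ?_ (by rw [hG]; rfl)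
  rw [injective_iff_map_eq_one]
  intro g hg
  by_contra hne
  have hfin : (fixedBy P g).Finite := Set.finite_of_ncard_ne_zero (by rw [h2 g hne]; decide)
  have hsub : orbit G x ⊆ fixedBy P g := by
    intro y hy
    have := congrArg (fun σ : Equiv.Perm (orbit G x) => ((σ ⟨y, hy⟩ : orbit G x) : P)) hg
    exact this
  have := Set.ncard_le_ncard hsub hfin
  rw [ho, h2 g hne] at this
  omega

lemma ker_sylow_dvd (p : ℕ) [Fact p.Prime] :
    Nat.card (MulAction.toPermHom G (Sylow p G)).ker * Nat.card (Sylow p G) ∣ Nat.card G := by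
  obtain ⟨Q⟩ : Nonempty (Sylow p G) := inferInstance
  have h1 : (MulAction.toPermHom G (Sylow p G)).ker ≤ stabilizer G Q := by
    intro g hg
    exact congrArg (fun σ : Equiv.Perm (Sylow p G) => σ Q) (MonoidHom.mem_ker.1 hg)
  rw [Q.card_eq_index_normalizer, ← Sylow.stabilizer_eq_normalizer,
    ← (stabilizer G Q).card_mul_index]
  exact Nat.mul_dvd_mul_right (Subgroup.card_dvd_of_le h1) _

lemma mem_sylow_of_ker (p : ℕ) [Fact p.Prime] {t : G}
    (ht : t ∈ (MulAction.toPermHom G (Sylow p G)).ker) (ho : orderOf t = p) (Q : Sylow p G) :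
    t ∈ Q := by
  have hp : IsPGroup p (Subgroup.zpowers t) := by
    apply IsPGroup.of_card (n := 1)
    rw [Nat.card_zpowers, ho, pow_one]
  have h1 : t ∈ stabilizer G Q :=
    congrArg (fun σ : Equiv.Perm (Sylow p G) => σ Q) (MonoidHom.mem_ker.1 ht)
  rw [Sylow.stabilizer_eq_normalizer] at h1
  have := hp.inf_normalizer_sylow Q
  have h3 : t ∈ Subgroup.zpowers t ⊓ Subgroup.normalizer (Q : Set G) :=
    ⟨Subgroup.mem_zpowers t, h1⟩
  rw [this] at h3
  exact h3.2

lemma no_normal_prime (hE : ∀ t : G, t ≠ 1 → ¬ ∀ g, g * t * g⁻¹ ∈ Subgroup.zpowers t)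
    (M : Subgroup G) [M.Normal] (q : ℕ) (hq : q.Prime) (hM : Nat.card M = q) : False := by
  have := Fact.mk hq
  obtain ⟨⟨t, htM⟩, ht⟩ := exists_prime_orderOf_dvd_card' (G := M) q (by rw [hM])
  have ht' : orderOf t = q := by rw [← ht]; exact (Subgroup.orderOf_mk t htM).symm
  have hz : Subgroup.zpowers t = M := by
    apply Subgroup.eq_of_le_of_card_ge
    · simpa using htM
    · rw [Nat.card_zpowers, ht', hM]
  refine hE t ?_ ?_
  · rintro rfl; rw [orderOf_one] at ht'; exact hq.one_lt.ne ht'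
  · intro g; rw [hz]; exact Subgroup.Normal.conj_mem inferInstance t htM g

lemma s4_case (hE : ∀ t : G, t ≠ 1 → ¬ ∀ g, g * t * g⁻¹ ∈ Subgroup.zpowers t)
    (hG : Nat.card G = 24) : Nonempty (G ≃* Equiv.Perm (Fin 4)) := by
  have h3 : Fact (Nat.Prime 3) := ⟨by norm_num⟩
  have hcard : ∀ Q : Sylow 3 G, Nat.card Q = 3 := by
    intro Q
    rw [Q.card_eq_multiplicity, hG, show (24 : ℕ) = 3 ^ 1 * 8 by norm_num,
      Nat.factorization_mul (by norm_num) (by norm_num)]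
    have : Nat.factorization 8 3 = 0 := Nat.factorization_eq_zero_of_not_dvd (by norm_num)
    simp [this, Nat.Prime.factorization_self h3.out]
  obtain ⟨Q⟩ : Nonempty (Sylow 3 G) := inferInstance
  have hn : Nat.card (Sylow 3 G) = 4 := by
    have h8 : (Q : Subgroup G).index = 8 := by
      have := (Q : Subgroup G).card_mul_index
      have hQ : Nat.card (Q : Subgroup G) = 3 := hcard Q
      rw [hG, hQ] at this; omega
    have hd : Nat.card (Sylow 3 G) ∣ 8 := h8 ▸ Q.card_dvd_index
    have hm := card_sylow_modEq_one 3 G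
    have hle := Nat.le_of_dvd (by norm_num) hd
    have hne : Nat.card (Sylow 3 G) ≠ 1 := by
      intro h1
      have : Subsingleton (Sylow 3 G) := (Nat.card_eq_one_iff_unique.1 h1).1
      have : (Q : Subgroup G).Normal := Sylow.normal_of_subsingleton Q
      exact no_normal_prime hE (Q : Subgroup G) 3 h3.out (hcard Q)
    unfold Nat.ModEq at hm
    interval_cases Nat.card (Sylow 3 G) <;> omega
  refine symmetric_of_embed (α := Sylow 3 G) 4 hn (MulAction.toPermHom G (Sylow 3 G)) ?_
    (by rw [hG]; rfl)
  rw [← MonoidHom.ker_eq_bot_iff, ← Subgroup.card_eq_one]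
  have hd := ker_sylow_dvd (G := G) 3
  rw [hn, hG, show 24 = 6 * 4 by norm_num] at hd
  replace hd := Nat.dvd_of_mul_dvd_mul_right (by norm_num) hd
  have hk3 : ¬ 3 ∣ Nat.card (MulAction.toPermHom G (Sylow 3 G)).ker := by
    intro hdv
    obtain ⟨⟨t, htM⟩, ht⟩ := exists_prime_orderOf_dvd_card'
      (G := (MulAction.toPermHom G (Sylow 3 G)).ker) 3 hdv
    have ht' : orderOf t = 3 := by rw [← ht]; exact (Subgroup.orderOf_mk t htM).symm
    have hz : ∀ R : Sylow 3 G, Subgroup.zpowers t = (R : Subgroup G) := by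
      intro R
      apply Subgroup.eq_of_le_of_card_ge
      · rw [Subgroup.zpowers_le]; exact mem_sylow_of_ker 3 htM ht' R
      · rw [Nat.card_zpowers, ht']; exact (hcard R).le
    have : Subsingleton (Sylow 3 G) := ⟨fun R S => Sylow.ext ((hz R).symm.trans (hz S))⟩
    rw [Nat.card_of_subsingleton Q] at hn
    omega
  have hk2 : Nat.card (MulAction.toPermHom G (Sylow 3 G)).ker ≠ 2 := fun h =>
    no_normal_prime hE _ 2 Nat.prime_two h
  have hle := Nat.le_of_dvd (by norm_num) hd
  have hpos : 0 < Nat.card (MulAction.toPermHom G (Sylow 3 G)).ker := Nat.card_pos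
  interval_cases Nat.card (MulAction.toPermHom G (Sylow 3 G)).ker <;> omega

end geometry
end FinPGL

namespace FinPGL

open MulAction
section geometry

variable {G P : Type*} [Group G] [Finite G] [MulAction G P]

lemma a5_case (h2 : ∀ g : G, g ≠ 1 → (fixedBy P g).ncard = 2)
    (hE : ∀ t : G, t ≠ 1 → ¬ ∀ g, g * t * g⁻¹ ∈ Subgroup.zpowers t)
    (hG : Nat.card G = 60) (x : P) (hx : Nat.card (stabilizer G x) = 2)
    (h235 : ∀ y : P, Nat.card (stabilizer G y) = 2 ∨ Nat.card (stabilizer G y) = 3 ∨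
      Nat.card (stabilizer G y) = 5)
    (horb : ∀ y : P, Nat.card (stabilizer G y) = 2 → y ∈ orbit G x) :
    Nonempty (G ≃* alternatingGroup (Fin 5)) := by
  classical
  have hp2 : Fact (Nat.Prime 2) := ⟨Nat.prime_two⟩
  have hcard : ∀ Q : Sylow 2 G, Nat.card Q = 4 := by
    intro Q
    rw [Q.card_eq_multiplicity, hG, show (60 : ℕ) = 2 ^ 2 * 15 by norm_num,
      Nat.factorization_mul (by norm_num) (by norm_num)]
    have : Nat.factorization 15 2 = 0 := Nat.factorization_eq_zero_of_not_dvd (by norm_num)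
    rw [Nat.factorization_pow, Finsupp.add_apply, this]
    simp [Nat.Prime.factorization_self hp2.out]
  have hfix : ∀ t : G, t ≠ 1 → ∃ y : P, t ∈ stabilizer G y := by
    intro t ht
    obtain ⟨y, hy⟩ := Set.nonempty_of_ncard_ne_zero (s := fixedBy P t) (by rw [h2 t ht]; decide)
    exact ⟨y, hy⟩
  -- a nontrivial element of order dividing 4 has order two, and its fixed points are in the orbit
  have hstab2 : ∀ t : G, t ≠ 1 → t ^ 4 = 1 → ∀ y : P, t ∈ stabilizer G y →
      Nat.card (stabilizer G y) = 2 := by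
    intro t ht h4 y hy
    have hd : orderOf t ∣ Nat.card (stabilizer G y) := by
      rw [← Subgroup.orderOf_mk t hy]; exact orderOf_dvd_natCard _
    have hd4 : orderOf t ∣ 4 := orderOf_dvd_of_pow_eq_one h4
    rcases h235 y with h | h | h
    · exact h
    · exfalso; apply ht; rw [← orderOf_eq_one_iff]
      rw [h] at hd; exact Nat.dvd_one.1 (by simpa using Nat.dvd_gcd hd hd4)
    · exfalso; apply ht; rw [← orderOf_eq_one_iff]
      rw [h] at hd; exact Nat.dvd_one.1 (by simpa using Nat.dvd_gcd hd hd4)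
  have hpow4 : ∀ (Q : Sylow 2 G) (t : G), t ∈ Q → t ^ 4 = 1 := by
    intro Q t ht
    have : (⟨t, ht⟩ : Q) ^ 4 = 1 := by rw [← hcard Q]; exact pow_card_eq_one'
    exact congrArg Subtype.val this
  have hsq : ∀ t : G, t ≠ 1 → t ^ 4 = 1 → t ^ 2 = 1 := by
    intro t ht h4
    obtain ⟨y, hy⟩ := hfix t ht
    have h := hstab2 t ht h4 y hy
    have : (⟨t, hy⟩ : stabilizer G y) ^ 2 = 1 := by rw [← h]; exact pow_card_eq_one'
    exact congrArg Subtype.val this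
  have hcent : ∀ (t : G), t ≠ 1 → ∀ (Q : Sylow 2 G), t ∈ Q →
      (Q : Subgroup G) = Subgroup.centralizer {t} := by
    intro t ht Q htQ
    obtain ⟨y, hy⟩ := hfix t ht
    have h := hstab2 t ht (hpow4 Q t htQ) y hy
    apply Subgroup.eq_of_le_of_card_ge
    · intro u hu
      have hone : ∀ v : G, v ∈ Q → v * v = 1 := by
        intro v hv
        by_cases hv1 : v = 1
        · simp [hv1]
        · rw [← pow_two]; exact hsq v hv1 (hpow4 Q v hv)
      have huQ : u ∈ Q := hu
      rw [Subgroup.mem_centralizer_singleton_iff]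
      have e1 := hone u huQ
      have e2 := hone t htQ
      have e3 := hone (u * t) (mul_mem huQ htQ)
      have i1 : u⁻¹ = u := inv_eq_of_mul_eq_one_left e1
      have i2 : t⁻¹ = t := inv_eq_of_mul_eq_one_left e2
      have i3 : (u * t)⁻¹ = u * t := inv_eq_of_mul_eq_one_left e3
      rw [_root_.mul_inv_rev, i1, i2] at i3
      first | exact i3 | exact i3.symm
    · have := card_le_of_conj h2 ht (Subgroup.centralizer {t}) (by
        intro g hg
        rw [Subgroup.mem_centralizer_singleton_iff] at hg
        have : g * t * g⁻¹ = t := by rw [hg]; group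
        rw [this]; exact Subgroup.mem_zpowers t) (x := y) hy
      rw [h] at this
      refine this.trans ?_
      exact (hcard Q).ge
  have huniq : ∀ (t : G), t ≠ 1 → ∀ (Q R : Sylow 2 G), t ∈ Q → t ∈ R → Q = R := by
    intro t ht Q R hQ hR
    exact Sylow.ext ((hcent t ht Q hQ).trans (hcent t ht R hR).symm)
  have ho : (orbit G x).ncard = 30 := by
    have := orbit_card (G := G) x
    rw [hx, hG] at this; omega
  -- involutions
  let T := {t : G // t ≠ 1 ∧ t ^ 2 = 1}
  have hT : Nat.card T = 15 := by
    have : Fintype G := Fintype.ofFinite G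
    have : Fintype T := Fintype.ofFinite T
    have hTfin : ∀ t : T, Finite (fixedBy P t.1) := fun t =>
      Set.finite_of_ncard_ne_zero (by rw [h2 t.1 t.2.1]; decide)
    let f : (Σ t : T, fixedBy P t.1) → orbit G x := fun z =>
      ⟨z.2.1, horb _ (hstab2 z.1.1 z.1.2.1
        (by rw [show 4 = 2 * 2 from rfl, pow_mul, z.1.2.2, one_pow]) _ z.2.2)⟩
    have hfb : Function.Bijective f := by
      constructor
      · rintro ⟨⟨t, ht1, ht2⟩, ⟨y, hy⟩⟩ ⟨⟨u, hu1, hu2⟩, ⟨z, hz⟩⟩ hyz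
        have : y = z := congrArg Subtype.val hyz
        subst this
        have hc : Nat.card (stabilizer G y) = 2 := hstab2 t ht1
          (by rw [show 4 = 2 * 2 from rfl, pow_mul, ht2, one_pow]) y hy
        have : t = u := by
          have hzz : Subgroup.zpowers t = stabilizer G y := by
            apply Subgroup.eq_of_le_of_card_ge
            · rw [Subgroup.zpowers_le]; exact hy
            · rw [Nat.card_zpowers, orderOf_eq_prime ht2 ht1, hc]
          have hu : u ∈ stabilizer G y := hz
          rw [← hzz] at hu
          rw [mem_zpowers_iff_mem_range_orderOf, orderOf_eq_prime ht2 ht1] at hu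
          obtain ⟨k, hk, hk'⟩ := Finset.mem_image.1 hu
          have : k < 2 := Finset.mem_range.1 hk
          interval_cases k
          · exact absurd hk'.symm (by simpa using hu1)
          · simpa using hk'
        subst this
        rfl
      · rintro ⟨y, hy⟩
        have hc : Nat.card (stabilizer G y) = 2 := by
          have h1 := orbit_card (G := G) y
          rw [orbit_eq_iff.2 hy, ho, hG] at h1; omega
        obtain ⟨⟨t, htM⟩, ht⟩ := exists_prime_orderOf_dvd_card' (G := stabilizer G y) 2 (by rw [hc])
        have ht' : orderOf t = 2 := by rw [← ht]; exact (Subgroup.orderOf_mk t htM).symm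
        refine ⟨⟨⟨t, ?_, ?_⟩, ⟨y, htM⟩⟩, rfl⟩
        · rintro rfl; simp at ht'
        · rw [← ht']; exact pow_orderOf_eq_one t
    have := Nat.card_congr (Equiv.ofBijective f hfb)
    rw [Nat.card_coe_set_eq, ho, Nat.card_sigma] at this
    have h22 : ∀ t : T, Nat.card (fixedBy P t.1) = 2 := fun t => by
      rw [Nat.card_coe_set_eq, h2 t.1 t.2.1]
    simp only [h22, Finset.sum_const, Finset.card_univ, smul_eq_mul] at this
    rw [Nat.card_eq_fintype_card]; omega
  have hn : Nat.card (Sylow 2 G) = 5 := by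
    have : Fintype (Sylow 2 G) := Fintype.ofFinite _
    let f : (Σ Q : Sylow 2 G, {t : Q // t ≠ 1}) → T := fun z =>
      have h1 : (z.2.1 : G) ≠ 1 := fun h => z.2.2 (Subtype.ext h)
      ⟨z.2.1, h1, hsq _ h1 (hpow4 z.1 _ z.2.1.2)⟩
    have hfb : Function.Bijective f := by
      constructor
      · rintro ⟨Q, ⟨⟨t, htQ⟩, ht⟩⟩ ⟨R, ⟨⟨u, huR⟩, hu⟩⟩ htu
        have : t = u := congrArg Subtype.val htu
        subst this
        have h1 : t ≠ 1 := fun h => ht (Subtype.ext h)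
        have := huniq t h1 Q R htQ huR
        subst this
        rfl
      · rintro ⟨t, ht1, ht2⟩
        have hp : IsPGroup 2 (Subgroup.zpowers t) := by
          apply IsPGroup.of_card (n := 1)
          rw [Nat.card_zpowers, orderOf_eq_prime ht2 ht1, pow_one]
        obtain ⟨Q, hQ⟩ := hp.exists_le_sylow
        exact ⟨⟨Q, ⟨⟨t, hQ (Subgroup.mem_zpowers t)⟩, fun h => ht1 (congrArg Subtype.val h)⟩⟩, rfl⟩
    have := Nat.card_congr (Equiv.ofBijective f hfb)
    rw [hT, Nat.card_sigma] at this
    have h33 : ∀ Q : Sylow 2 G, Nat.card {t : Q // t ≠ 1} = 3 := fun Q => by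
      have : Fintype Q := Fintype.ofFinite _
      rw [Nat.card_eq_fintype_card, Fintype.card_subtype_compl, Fintype.card_subtype_eq,
        ← Nat.card_eq_fintype_card]
      have h4 : Nat.card Q = 4 := hcard Q
      change Nat.card (Q : Subgroup G) - 1 = 3
      omega
    simp only [h33, Finset.sum_const, Finset.card_univ, smul_eq_mul] at this
    rw [Nat.card_eq_fintype_card]; omega
  refine alternating_of_embed (α := Sylow 2 G) 5 hn (MulAction.toPermHom G (Sylow 2 G)) ?_
    (by rw [hG]; rfl)
  rw [← MonoidHom.ker_eq_bot_iff, ← Subgroup.card_eq_one]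
  have hd := ker_sylow_dvd (G := G) 2
  rw [hn, hG, show 60 = 12 * 5 by norm_num] at hd
  replace hd := Nat.dvd_of_mul_dvd_mul_right (by norm_num) hd
  have hk2 : ¬ 2 ∣ Nat.card (MulAction.toPermHom G (Sylow 2 G)).ker := by
    intro hdv
    obtain ⟨⟨t, htM⟩, ht⟩ := exists_prime_orderOf_dvd_card'
      (G := (MulAction.toPermHom G (Sylow 2 G)).ker) 2 hdv
    have ht' : orderOf t = 2 := by rw [← ht]; exact (Subgroup.orderOf_mk t htM).symm
    have ht1 : t ≠ 1 := by rintro rfl; simp at ht'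
    have : Subsingleton (Sylow 2 G) := ⟨fun R S => huniq t ht1 R S
      (mem_sylow_of_ker 2 htM ht' R) (mem_sylow_of_ker 2 htM ht' S)⟩
    obtain ⟨Q⟩ : Nonempty (Sylow 2 G) := inferInstance
    rw [Nat.card_of_subsingleton Q] at hn
    omega
  have hk3 : Nat.card (MulAction.toPermHom G (Sylow 2 G)).ker ≠ 3 := fun h =>
    no_normal_prime hE _ 3 Nat.prime_three h
  have hle := Nat.le_of_dvd (by norm_num) hd
  have hpos : 0 < Nat.card (MulAction.toPermHom G (Sylow 2 G)).ker := Nat.card_pos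
  interval_cases Nat.card (MulAction.toPermHom G (Sylow 2 G)).ker <;> omega

end geometry
end FinPGL

namespace FinPGL

open MulAction

lemma numeric_sorted (a b c N : ℕ) (ha : 2 ≤ a) (hab : a ≤ b) (hbc : b ≤ c) (hN : 0 < N)
    (h : (1 : ℚ) / a + 1 / b + 1 / c = 1 + 2 / N) :
    2 * c = N ∨ (a = 2 ∧ b = 3 ∧ c = 3 ∧ N = 12) ∨ (a = 2 ∧ b = 3 ∧ c = 4 ∧ N = 24) ∨
      (a = 2 ∧ b = 3 ∧ c = 5 ∧ N = 60) := by
  have hNq : (0 : ℚ) < N := by exact_mod_cast hN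
  have hpos : (0 : ℚ) < 2 / N := by positivity
  have inv_le : ∀ k m : ℕ, 0 < k → k ≤ m → (1 : ℚ) / m ≤ 1 / k := by
    intro k m hk hkm
    have : (0 : ℚ) < k := by exact_mod_cast hk
    apply one_div_le_one_div_of_le this
    exact_mod_cast hkm
  have ha2 : a = 2 := by
    by_contra hne
    have h1 := inv_le 3 a (by norm_num) (by omega)
    have h2 := inv_le 3 b (by norm_num) (by omega)
    have h3 := inv_le 3 c (by norm_num) (by omega)
    push_cast at h1 h2 h3
    linarith
  subst ha2
  have hb : b < 4 := by
    by_contra hne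
    have h2 := inv_le 4 b (by norm_num) (by omega)
    have h3 := inv_le 4 c (by norm_num) (by omega)
    push_cast at h h2 h3
    linarith
  have hc0 : (0 : ℚ) < c := by
    have : 0 < c := by omega
    exact_mod_cast this
  interval_cases b
  · left
    have h1 : (1 : ℚ) / c = 2 / N := by push_cast at h; linarith
    field_simp at h1
    have : ((2 * c : ℕ) : ℚ) = N := by push_cast; linarith
    exact_mod_cast this
  · right
    have hc : c < 6 := by
      by_contra hne
      have h3 := inv_le 6 c (by norm_num) (by omega)
      push_cast at h h3
      linarith
    have key : ∀ m : ℕ, 2 / (N : ℚ) = 2 / m → 0 < m → N = m := by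
      intro m hm hm0
      have hmq : (m : ℚ) ≠ 0 := by exact_mod_cast hm0.ne'
      field_simp at hm
      exact_mod_cast hm.symm
    interval_cases c
    · left; refine ⟨rfl, rfl, rfl, key 12 ?_ (by norm_num)⟩; push_cast at h ⊢; linarith
    · right; left; refine ⟨rfl, rfl, rfl, key 24 ?_ (by norm_num)⟩; push_cast at h ⊢; linarith
    · right; right; refine ⟨rfl, rfl, rfl, key 60 ?_ (by norm_num)⟩; push_cast at h ⊢; linarith

lemma numeric_two (a b N : ℕ) (ha : 0 < a) (hb : 0 < b) (haN : a ≤ N) (hbN : b ≤ N)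
    (h : (1 : ℚ) / a + 1 / b = 2 / N) : a = N := by
  have haq : (0 : ℚ) < a := by exact_mod_cast ha
  have hbq : (0 : ℚ) < b := by exact_mod_cast hb
  have h1 : (a : ℚ) ≤ N := by exact_mod_cast haN
  have h2 : (1 : ℚ) / N ≤ 1 / b := one_div_le_one_div_of_le hbq (by exact_mod_cast hbN)
  have hNq : (0 : ℚ) < N := haq.trans_le h1
  have h3 : (1 : ℚ) / a ≤ 1 / N := by
    have : (2 : ℚ) / N = 1 / N + 1 / N := by ring
    linarith
  have h4 := (one_div_le_one_div haq hNq).1 h3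
  have : N ≤ a := by exact_mod_cast h4
  omega

section geometry

variable {G P : Type*} [Group G] [Finite G] [MulAction G P]

lemma stab_card_eq {x y : P} (h : y ∈ orbit G x) :
    Nat.card (stabilizer G y) = Nat.card (stabilizer G x) := by
  have h1 := orbit_card (G := G) y
  have h2 := orbit_card (G := G) x
  rw [orbit_eq_iff.2 h, ← h2] at h1
  refine Nat.eq_of_mul_eq_mul_left ?_ h1
  rcases Nat.eq_zero_or_pos (orbit G x).ncard with h0 | h0
  · rw [h0, zero_mul] at h2
    exact absurd h2.symm Nat.card_pos.ne'
  · exact h0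

lemma orbit_formula [Finite P] [Fintype (orbitRel.Quotient G P)]
    (h2 : ∀ g : G, g ≠ 1 → (fixedBy P g).ncard = 2) :
    ∑ ω : orbitRel.Quotient G P, (1 - 1 / (Nat.card (stabilizer G ω.out) : ℚ)) =
      2 - 2 / (Nat.card G : ℚ) := by
  classical
  have : Fintype G := Fintype.ofFinite G
  have : Fintype P := Fintype.ofFinite P
  have hB := sum_card_fixedBy_eq_card_orbits_mul_card_group G P
  have hC := card_eq_sum_card_group_div_card_stabilizer G P
  rw [← Finset.add_sum_erase _ _ (Finset.mem_univ (1 : G))] at hB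
  have h1 : Fintype.card (fixedBy P (1 : G)) = Fintype.card P := by
    rw [← Nat.card_eq_fintype_card, ← Nat.card_eq_fintype_card, Nat.card_coe_set_eq]
    simp
  have h3 : ∑ g ∈ Finset.univ.erase (1 : G), Fintype.card (fixedBy P g) =
      (Fintype.card G - 1) * 2 := by
    rw [Finset.sum_congr rfl (g := fun _ => 2)]
    · rw [Finset.sum_const, Finset.card_erase_of_mem (Finset.mem_univ _), Finset.card_univ,
        smul_eq_mul]
    · intro g hg
      rw [← Nat.card_eq_fintype_card, Nat.card_coe_set_eq, h2 g (Finset.ne_of_mem_erase hg)]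
  rw [h1, h3, hC] at hB
  have hN : (0 : ℚ) < Fintype.card G := by exact_mod_cast Fintype.card_pos
  have hB' := congrArg (Nat.cast : ℕ → ℚ) hB
  have hcast : ∀ ω : orbitRel.Quotient G P,
      ((Fintype.card G / Fintype.card (stabilizer G ω.out) : ℕ) : ℚ) =
        Fintype.card G * (1 / (Nat.card (stabilizer G ω.out) : ℚ)) := by
    intro ω
    rw [Nat.cast_div, Nat.card_eq_fintype_card]
    · ring
    · rw [← Nat.card_eq_fintype_card, ← Nat.card_eq_fintype_card]
      exact Subgroup.card_subgroup_dvd_card _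
    · exact_mod_cast Fintype.card_pos.ne'
  rw [Nat.cast_add, Nat.cast_sum, Nat.cast_mul, Nat.cast_mul,
    Nat.cast_sub Fintype.card_pos] at hB'
  simp only [hcast] at hB'
  rw [← Finset.mul_sum] at hB'
  rw [Finset.sum_sub_distrib, Finset.sum_const, Finset.card_univ, nsmul_eq_mul, mul_one,
    Nat.card_eq_fintype_card (α := G)]
  push_cast at hB'
  field_simp
  linarith

theorem abstract_classification [Finite P] 
    (h2 : ∀ g : G, g ≠ 1 → (fixedBy P g).ncard = 2)
    (hnt : ∀ x : P, stabilizer G x ≠ ⊥) (hcyc : ∀ x : P, IsCyclic (stabilizer G x)) :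
    (∃ m : ℕ, 1 ≤ m ∧ Nonempty (G ≃* Multiplicative (ZMod m))) ∨
    (∃ n : ℕ, 1 ≤ n ∧ Nonempty (G ≃* DihedralGroup n)) ∨
    Nonempty (G ≃* alternatingGroup (Fin 4)) ∨
    Nonempty (G ≃* Equiv.Perm (Fin 4)) ∨
    Nonempty (G ≃* alternatingGroup (Fin 5)) := by
  classical
  have hcycG : IsCyclic G → (∃ m : ℕ, 1 ≤ m ∧ Nonempty (G ≃* Multiplicative (ZMod m))) :=
    fun h => ⟨Nat.card G, Nat.card_pos, ⟨(zmodCyclicMulEquiv h).symm⟩⟩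
  by_cases hG : Nat.card G = 1
  · left
    have : Subsingleton G := (Nat.card_eq_one_iff_unique.1 hG).1
    exact hcycG inferInstance
  have : Fintype (orbitRel.Quotient G P) := Fintype.ofFinite _
  have hsum := orbit_formula (G := G) (P := P) h2
  set e : orbitRel.Quotient G P → ℕ := fun ω => Nat.card (stabilizer G ω.out) with he
  have hN : 0 < Nat.card G := Nat.card_pos
  have hN2 : 2 ≤ Nat.card G := by omega
  have hNq : (2 : ℚ) ≤ Nat.card G := by exact_mod_cast hN2
  have he2 : ∀ ω, 2 ≤ e ω := by
    intro ω
    have h1 : Nat.card (stabilizer G ω.out) ≠ 1 := fun h =>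
      hnt _ (Subgroup.card_eq_one.1 h)
    have h0 : 0 < Nat.card (stabilizer G ω.out) := Nat.card_pos
    change 2 ≤ Nat.card (stabilizer G ω.out)
    omega
  have heN : ∀ ω, e ω ≤ Nat.card G := fun ω => Subgroup.card_le_card_group _
  have hey : ∀ y : P, ∀ ω : orbitRel.Quotient G P, Quotient.mk'' y = ω → y ∈ orbit G ω.out := by
    rintro y ω rfl
    have : (Quotient.mk'' y : orbitRel.Quotient G P) =
        Quotient.mk'' (Quotient.mk'' y : orbitRel.Quotient G P).out := (Quotient.out_eq' _).symm
    exact orbitRel_apply.1 (Quotient.eq''.1 this)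
  have hey' : ∀ y : P, Nat.card (stabilizer G y) = e (Quotient.mk'' y) := fun y =>
    stab_card_eq (hey y _ rfl)
  -- the number of orbits
  have hterm : ∀ ω, (1 : ℚ) / 2 ≤ 1 - 1 / (e ω : ℚ) ∧ 1 - 1 / (e ω : ℚ) < 1 := by
    intro ω
    have h1 : (2 : ℚ) ≤ e ω := by exact_mod_cast he2 ω
    have h3 : (1 : ℚ) / e ω ≤ 1 / 2 := one_div_le_one_div_of_le (by norm_num) h1
    have h4 : (0 : ℚ) < 1 / e ω := by positivity
    constructor <;> linarith
  have hlow : (1 : ℚ) / 2 * Fintype.card (orbitRel.Quotient G P) ≤ 2 - 2 / Nat.card G := by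
    rw [← hsum]
    have := Finset.card_nsmul_le_sum (Finset.univ : Finset (orbitRel.Quotient G P))
      (fun ω => 1 - 1 / (e ω : ℚ)) (1 / 2) (fun ω _ => (hterm ω).1)
    rw [nsmul_eq_mul, Finset.card_univ] at this
    linarith
  have hNpos : (0 : ℚ) < 2 / Nat.card G := by positivity
  have hN1 : (2 : ℚ) / Nat.card G ≤ 1 := by rw [div_le_one (by positivity)]; exact hNq
  have hr4 : Fintype.card (orbitRel.Quotient G P) < 4 := by
    have : (Fintype.card (orbitRel.Quotient G P) : ℚ) < 4 := by linarith
    exact_mod_cast this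
  have hr : Fintype.card (orbitRel.Quotient G P) = 2 ∨
      Fintype.card (orbitRel.Quotient G P) = 3 := by
    by_contra hcon
    have h01 : Fintype.card (orbitRel.Quotient G P) = 0 ∨
      Fintype.card (orbitRel.Quotient G P) = 1 := by omega
    rcases h01 with h0 | h1
    · have : (Finset.univ : Finset (orbitRel.Quotient G P)) = ∅ := by
        rw [← Finset.card_eq_zero, Finset.card_univ, h0]
      rw [this, Finset.sum_empty] at hsum
      linarith
    · obtain ⟨ω, hω⟩ := Finset.card_eq_one.1 ((Finset.card_univ).trans h1)
      rw [hω, Finset.sum_singleton] at hsum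
      have := (hterm ω).2
      change 1 - 1 / (e ω : ℚ) = _ at hsum
      linarith
  rcases hr with hr | hr
  · left
    obtain ⟨ω₁, ω₂, hne, huniv⟩ := Finset.card_eq_two.1 ((Finset.card_univ).trans hr)
    rw [huniv, Finset.sum_pair hne] at hsum
    change 1 - 1 / (e ω₁ : ℚ) + (1 - 1 / (e ω₂ : ℚ)) = _ at hsum
    have h := numeric_two (e ω₁) (e ω₂) (Nat.card G) (by have := he2 ω₁; omega)
      (by have := he2 ω₂; omega) (heN _) (heN _) (by linarith)
    have htop : stabilizer G ω₁.out = ⊤ := Subgroup.eq_top_of_card_eq _ h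
    have := hcyc ω₁.out
    rw [htop] at this
    exact hcycG (isCyclic_of_surjective (Subgroup.topEquiv (G := G)) Subgroup.topEquiv.surjective)
  · right
    obtain ⟨ω₁, ω₂, ω₃, h12, h13, h23, huniv⟩ :=
      Finset.card_eq_three.1 ((Finset.card_univ).trans hr)
    rw [huniv, Finset.sum_insert (by simp [h12, h13]), Finset.sum_pair h23] at hsum
    change 1 - 1 / (e ω₁ : ℚ) + (1 - 1 / (e ω₂ : ℚ) + (1 - 1 / (e ω₃ : ℚ))) = _ at hsum
    have hall : ∀ ω : orbitRel.Quotient G P, ω = ω₁ ∨ ω = ω₂ ∨ ω = ω₃ := by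
      intro ω
      have := Finset.mem_univ ω
      rw [huniv] at this
      simpa using this
    have hfin : ∀ α β γ : orbitRel.Quotient G P, (∀ ω, ω = α ∨ ω = β ∨ ω = γ) →
        e α ≤ e β → e β ≤ e γ → (1 : ℚ) / e α + 1 / e β + 1 / e γ = 1 + 2 / Nat.card G →
        (∃ n : ℕ, 1 ≤ n ∧ Nonempty (G ≃* DihedralGroup n)) ∨
        Nonempty (G ≃* alternatingGroup (Fin 4)) ∨
        Nonempty (G ≃* Equiv.Perm (Fin 4)) ∨
        Nonempty (G ≃* alternatingGroup (Fin 5)) := by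
      intro α β γ hall hab hbc hs
      have hE : e γ ≤ 5 → 10 < Nat.card G →
          ∀ t : G, t ≠ 1 → ¬ ∀ g, g * t * g⁻¹ ∈ Subgroup.zpowers t := by
        intro h5 h10 t ht hcon
        obtain ⟨y, hy⟩ := Set.nonempty_of_ncard_ne_zero (s := fixedBy P t)
          (by rw [h2 t ht]; decide)
        have h := card_le_of_conj h2 ht ⊤ (fun g _ => hcon g) hy
        rw [Subgroup.card_top, hey'] at h
        rcases hall (Quotient.mk'' y) with hh | hh | hh <;> rw [hh] at h <;> omega
      rcases numeric_sorted _ _ _ _ (he2 α) hab hbc hN hs with h | ⟨ha, hb, hc, h⟩ |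
        ⟨ha, hb, hc, h⟩ | ⟨ha, hb, hc, h⟩
      · left
        have := hcyc γ.out
        exact dihedral_case h2 γ.out h
      · right; left
        exact a4_case h2 γ.out hc h
      · right; right; left
        exact s4_case (hE (by omega) (by omega)) h
      · right; right; right
        refine a5_case h2 (hE (by omega) (by omega)) h α.out ha ?_ ?_
        · intro y
          rw [hey']
          rcases hall (Quotient.mk'' y) with hh | hh | hh <;> rw [hh] <;> omega
        · intro y hy
          rw [hey'] at hy
          apply hey
          rcases hall (Quotient.mk'' y) with hh | hh | hh
          · exact hh
          · rw [hh] at hy; omega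
          · rw [hh] at hy; omega
    rcases le_total (e ω₁) (e ω₂) with a | a <;> rcases le_total (e ω₂) (e ω₃) with b | b <;>
      rcases le_total (e ω₁) (e ω₃) with c | c
    · exact hfin ω₁ ω₂ ω₃ (fun ω => by have := hall ω; tauto) a b (by linarith)
    · exact hfin ω₁ ω₂ ω₃ (fun ω => by have := hall ω; tauto) a b (by linarith)
    · exact hfin ω₁ ω₃ ω₂ (fun ω => by have := hall ω; tauto) c b (by linarith)
    · exact hfin ω₃ ω₁ ω₂ (fun ω => by have := hall ω; tauto) c a (by linarith)
    · exact hfin ω₂ ω₁ ω₃ (fun ω => by have := hall ω; tauto) a c (by linarith)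
    · exact hfin ω₂ ω₃ ω₁ (fun ω => by have := hall ω; tauto) b c (by linarith)
    · exact hfin ω₃ ω₂ ω₁ (fun ω => by have := hall ω; tauto) b a (by linarith)
    · exact hfin ω₃ ω₂ ω₁ (fun ω => by have := hall ω; tauto) b a (by linarith)

end geometry
end FinPGL

namespace FinPGL

open MulAction

theorem abstract_classification' {G X : Type*} [Group G] [Finite G] [MulAction G X]
    (h2 : ∀ g : G, g ≠ 1 → (fixedBy X g).ncard = 2)
    (hcyc : ∀ x : X, IsCyclic (stabilizer G x)) :
    (∃ m : ℕ, 1 ≤ m ∧ Nonempty (G ≃* Multiplicative (ZMod m))) ∨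
    (∃ n : ℕ, 1 ≤ n ∧ Nonempty (G ≃* DihedralGroup n)) ∨
    Nonempty (G ≃* alternatingGroup (Fin 4)) ∨
    Nonempty (G ≃* Equiv.Perm (Fin 4)) ∨
    Nonempty (G ≃* alternatingGroup (Fin 5)) := by
  let S : SubMulAction G X :=
    { carrier := {x | ∃ g : G, g ≠ 1 ∧ g • x = x}
      smul_mem' := by
        rintro c x ⟨g, hg, hgx⟩
        refine ⟨c * g * c⁻¹, ?_, ?_⟩
        · intro h; apply hg
          have : g = c⁻¹ * (c * g * c⁻¹) * c := by group
          rw [this, h]; group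
        · rw [smul_smul, inv_mul_cancel_right, mul_smul, hgx] }
  have hSmem : ∀ x : X, x ∈ S ↔ ∃ g : G, g ≠ 1 ∧ g • x = x := fun x => Iff.rfl
  have hfin : (S : Set X).Finite := by
    have : (S : Set X) ⊆ ⋃ g ∈ {g : G | g ≠ 1}, fixedBy X g := by
      rintro x ⟨g, hg, hgx⟩
      simp only [Set.mem_iUnion]
      exact ⟨g, hg, hgx⟩
    refine Set.Finite.subset (Set.Finite.biUnion (Set.toFinite _) ?_) this
    intro g hg
    exact Set.finite_of_ncard_ne_zero (by rw [h2 g hg]; decide)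
  have : Finite S := hfin
  have hst : ∀ x : S, stabilizer G x = stabilizer G (x : X) := by
    intro x
    ext g
    simp only [mem_stabilizer_iff]
    rw [Subtype.ext_iff]; rfl
  refine abstract_classification (G := G) (P := S) ?_ ?_ ?_
  · intro g hg
    rw [← h2 g hg, ← Set.ncard_image_of_injective _ Subtype.val_injective]
    congr 1
    ext x
    constructor
    · rintro ⟨y, hy, rfl⟩
      exact congrArg Subtype.val hy
    · intro hx
      exact ⟨⟨x, g, hg, hx⟩, Subtype.ext hx, rfl⟩
  · rintro x hx
    obtain ⟨g, hg, hgx⟩ := x.2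
    apply hg
    rw [hst] at hx
    have : g ∈ stabilizer G (x : X) := hgx
    rw [hx] at this
    exact this
  · intro x
    rw [hst]
    exact hcyc _

section matrices

variable {L : Type*} [Field L]

lemma mulVec_two (M : Matrix (Fin 2) (Fin 2) L) (v : Fin 2 → L) (l : L) :
    M *ᵥ v = l • v ↔ M 0 0 * v 0 + M 0 1 * v 1 = l * v 0 ∧
      M 1 0 * v 0 + M 1 1 * v 1 = l * v 1 := by
  constructor
  · intro h
    have h0 := congrFun h 0
    have h1 := congrFun h 1
    simp only [mulVec, dotProduct, Fin.sum_univ_two, Pi.smul_apply, smul_eq_mul] at h0 h1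
    exact ⟨h0, h1⟩
  · rintro ⟨h0, h1⟩
    ext i
    fin_cases i
    · simpa [mulVec, dotProduct, Fin.sum_univ_two] using h0
    · simpa [mulVec, dotProduct, Fin.sum_univ_two] using h1

lemma ne_zero_two {v : Fin 2 → L} (hv : v ≠ 0) : v 0 ≠ 0 ∨ v 1 ≠ 0 := by
  by_contra! h
  apply hv
  ext i
  fin_cases i
  · exact h.1
  · exact h.2

lemma char_of_eigen (M : Matrix (Fin 2) (Fin 2) L) {v : Fin 2 → L} (hv : v ≠ 0) {l : L}
    (h : M *ᵥ v = l • v) : (M 0 0 - l) * (M 1 1 - l) - M 0 1 * M 1 0 = 0 := by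
  rw [mulVec_two] at h
  obtain ⟨h0, h1⟩ := h
  rcases ne_zero_two hv with hv | hv
  · refine (mul_eq_zero.1 ?_).resolve_right hv
    linear_combination (M 1 1 - l) * h0 - M 0 1 * h1
  · refine (mul_eq_zero.1 ?_).resolve_right hv
    linear_combination (M 0 0 - l) * h1 - M 1 0 * h0

lemma exists_eigen (M : Matrix (Fin 2) (Fin 2) L) {l : L}
    (h : (M 0 0 - l) * (M 1 1 - l) - M 0 1 * M 1 0 = 0) : ∃ v : Fin 2 → L, v ≠ 0 ∧
      M *ᵥ v = l • v := by
  have hdet : (M - l • (1 : Matrix (Fin 2) (Fin 2) L)).det = 0 := by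
    rw [det_fin_two]; simpa using h
  obtain ⟨v, hv, hv'⟩ := exists_mulVec_eq_zero_iff.2 hdet
  refine ⟨v, hv, ?_⟩
  rw [sub_mulVec, smul_mulVec, one_mulVec, sub_eq_zero] at hv'
  exact hv'

/-- If a power of `M` is scalar and `M` has a double eigenvalue then `M` is scalar. -/
lemma scalar_of_double [CharZero L] (M : Matrix (Fin 2) (Fin 2) L) {l : L} (hl : l ≠ 0)
    (htr : M 0 0 + M 1 1 = 2 * l) (hdet : M 0 0 * M 1 1 - M 0 1 * M 1 0 = l ^ 2)
    {n : ℕ} (hn : n ≠ 0) {c : L} (hc : M ^ n = c • (1 : Matrix (Fin 2) (Fin 2) L)) :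
    M = l • (1 : Matrix (Fin 2) (Fin 2) L) := by
  set N := M - l • (1 : Matrix (Fin 2) (Fin 2) L) with hN
  have hM : M = l • (1 : Matrix (Fin 2) (Fin 2) L) + N := by rw [hN]; abel
  have hNN : N * N = 0 := by
    have h11 : M 1 1 = 2 * l - M 0 0 := by linear_combination htr
    rw [h11] at hdet
    ext i j
    fin_cases i <;> fin_cases j <;> simp [hN, Matrix.mul_apply, Fin.sum_univ_two, h11]
    · linear_combination -hdet
    · ring
    · ring
    · linear_combination -hdet
  have hpow : ∀ k : ℕ, l • M ^ k =
      (l ^ (k + 1)) • (1 : Matrix (Fin 2) (Fin 2) L) + (k * l ^ k) • N := by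
    intro k
    induction k with
    | zero => simp
    | succ k ih =>
      rw [pow_succ, ← smul_mul_assoc, ih, hM]
      rw [← hM]
      conv_lhs => rw [hM]
      simp only [add_mul, mul_add, smul_mul_assoc, one_mul, mul_smul_comm, mul_one, hNN, smul_zero,
        add_zero, smul_smul, smul_add]
      push_cast
      module
  have h := hpow n
  rw [hc] at h
  have hk : (n * l ^ n : L) ≠ 0 := mul_ne_zero (by exact_mod_cast hn) (pow_ne_zero _ hl)
  have e01 := congrFun (congrFun h 0) 1
  have e10 := congrFun (congrFun h 1) 0
  have e00 := congrFun (congrFun h 0) 0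
  have e11 := congrFun (congrFun h 1) 1
  simp [hN, hn, hl] at e01 e10
  simp [hN] at e00 e11
  have hd : M 0 0 = M 1 1 := by
    have : (n * l ^ n : L) * (M 0 0 - M 1 1) = 0 := by linear_combination e11 - e00
    exact sub_eq_zero.1 ((mul_eq_zero.1 this).resolve_left hk)
  have h0 : M 0 0 = l := by
    have : (2 : L) * (M 0 0 - l) = 0 := by linear_combination htr + hd
    exact sub_eq_zero.1 ((mul_eq_zero.1 this).resolve_left two_ne_zero)
  ext i j
  fin_cases i <;> fin_cases j <;> simp [e01, e10, h0, ← hd]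

/-- version with an eigenvector -/
lemma scalar_of_eigen_det [CharZero L] (M : Matrix (Fin 2) (Fin 2) L) {l : L} (hl : l ≠ 0)
    {v : Fin 2 → L} (hv : v ≠ 0) (h : M *ᵥ v = l • v) (hdet : M.det = l ^ 2)
    {n : ℕ} (hn : n ≠ 0) {c : L} (hc : M ^ n = c • (1 : Matrix (Fin 2) (Fin 2) L)) :
    M = l • (1 : Matrix (Fin 2) (Fin 2) L) := by
  have hch := char_of_eigen M hv h
  rw [det_fin_two] at hdet
  refine scalar_of_double M hl ?_ hdet hn hc
  have : l * (M 0 0 + M 1 1 - 2 * l) = 0 := by linear_combination hdet - hch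
  exact sub_eq_zero.1 ((mul_eq_zero.1 this).resolve_left hl)

lemma proportional {v u : Fin 2 → L} (hv : v ≠ 0) (h : v 0 * u 1 = v 1 * u 0) :
    ∃ k : L, k • v = u := by
  rcases ne_zero_two hv with h0 | h0
  · refine ⟨u 0 / v 0, ?_⟩
    ext i; fin_cases i
    · simp; field_simp
    · simp; field_simp; linear_combination -h
  · refine ⟨u 1 / v 1, ?_⟩
    ext i; fin_cases i
    · simp; field_simp; linear_combination h
    · simp; field_simp

lemma scalar_of_two_eigen (M : Matrix (Fin 2) (Fin 2) L) {l : L} {v u : Fin 2 → L}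
    (hv : M *ᵥ v = l • v) (hu : M *ᵥ u = l • u) (h : v 0 * u 1 ≠ v 1 * u 0) :
    M = l • (1 : Matrix (Fin 2) (Fin 2) L) := by
  rw [mulVec_two] at hv hu
  obtain ⟨a, b⟩ := hv
  obtain ⟨c, d⟩ := hu
  have hD : v 0 * u 1 - v 1 * u 0 ≠ 0 := sub_ne_zero.2 h
  have e00 : M 0 0 = l := by
    refine sub_eq_zero.1 ((mul_eq_zero.1 (?_ : _ * (v 0 * u 1 - v 1 * u 0) = 0)).resolve_right hD)
    linear_combination u 1 * a - v 1 * c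
  have e01 : M 0 1 = 0 := by
    refine ((mul_eq_zero.1 (?_ : _ * (v 0 * u 1 - v 1 * u 0) = 0)).resolve_right hD)
    linear_combination v 0 * c - u 0 * a
  have e10 : M 1 0 = 0 := by
    refine ((mul_eq_zero.1 (?_ : _ * (v 0 * u 1 - v 1 * u 0) = 0)).resolve_right hD)
    linear_combination u 1 * b - v 1 * d
  have e11 : M 1 1 = l := by
    refine sub_eq_zero.1 ((mul_eq_zero.1 (?_ : _ * (v 0 * u 1 - v 1 * u 0) = 0)).resolve_right hD)
    linear_combination v 0 * d - u 0 * b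
  ext i j
  fin_cases i <;> fin_cases j <;> simp [e00, e01, e10, e11]

open scoped LinearAlgebra.Projectivization

/-- The fixed points on the projective line of a non-scalar matrix of finite projective order. -/
lemma two_fixed [CharZero L] [IsAlgClosed L] (A : GL (Fin 2) L)
    (hA : ∀ l : L, (A : Matrix (Fin 2) (Fin 2) L) ≠ l • 1)
    {n : ℕ} (hn : n ≠ 0) {c : L} (hc : (A : Matrix (Fin 2) (Fin 2) L) ^ n = c • 1) :
    (fixedBy (ℙ L (Fin 2 → L)) A).ncard = 2 := by
  set M : Matrix (Fin 2) (Fin 2) L := A.val with hM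
  have hdet0 : M 0 0 * M 1 1 - M 0 1 * M 1 0 ≠ 0 := by
    rw [← det_fin_two]
    exact (A.isUnit.map (detMonoidHom)).ne_zero
  obtain ⟨l, hl⟩ : ∃ l : L, (M 0 0 - l) * (M 1 1 - l) - M 0 1 * M 1 0 = 0 := by
    obtain ⟨l, hl⟩ := IsAlgClosed.exists_root M.charpoly (by rw [charpoly_degree_eq_dim]; simp)
    refine ⟨l, ?_⟩
    rw [charpoly_fin_two, Polynomial.IsRoot.def] at hl
    simp [trace_fin_two, det_fin_two] at hl
    linear_combination hl
  set m := M 0 0 + M 1 1 - l with hm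
  have hm' : (M 0 0 - m) * (M 1 1 - m) - M 0 1 * M 1 0 = 0 := by
    rw [hm]; linear_combination hl
  have hlm : l * m = M 0 0 * M 1 1 - M 0 1 * M 1 0 := by
    rw [hm]; linear_combination -hl
  have hl0 : l ≠ 0 := by rintro rfl; apply hdet0; rw [← hlm, zero_mul]
  have hne : l ≠ m := by
    intro h
    refine hA l (scalar_of_double M hl0 ?_ ?_ hn hc)
    · linear_combination hm - h
    · rw [← hlm, ← h]; ring
  obtain ⟨v, hv, hMv⟩ := exists_eigen M hl
  obtain ⟨w, hw, hMw⟩ := exists_eigen M hm'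
  have hfix : ∀ (u : Fin 2 → L) (hu : u ≠ 0),
      Projectivization.mk L u hu ∈ fixedBy (ℙ L (Fin 2 → L)) A ↔ ∃ k : L, M *ᵥ u = k • u := by
    intro u hu
    rw [mem_fixedBy, Projectivization.smul_mk, Projectivization.mk_eq_mk_iff']
    exact exists_congr fun k => eq_comm
  rw [Set.ncard_eq_two]
  refine ⟨Projectivization.mk L v hv, Projectivization.mk L w hw, ?_, ?_⟩
  · rw [Ne, Projectivization.mk_eq_mk_iff']
    rintro ⟨k, rfl⟩
    rw [mulVec_smul, hMw] at hMv
    apply hne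
    rw [smul_smul, smul_smul, mul_comm k m, ← sub_eq_zero, ← sub_smul, ← sub_mul, ← smul_smul,
      smul_eq_zero] at hMv
    rcases hMv with h | h
    · exact (sub_eq_zero.1 h).symm
    · exact absurd h hv
  · ext x
    induction x using Projectivization.ind with | _ u hu =>
    rw [hfix, Set.mem_insert_iff, Set.mem_singleton_iff, Projectivization.mk_eq_mk_iff',
      Projectivization.mk_eq_mk_iff']
    constructor
    · rintro ⟨k, hk⟩
      have hkch := char_of_eigen M hu hk
      have : (k - l) * (k - m) = 0 := by
        rw [hm]; linear_combination hkch - hl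
      rcases mul_eq_zero.1 this with h | h
      · left
        rw [sub_eq_zero.1 h] at hk
        refine proportional hv ?_
        by_contra hcon
        exact hA l (scalar_of_two_eigen M hMv hk hcon)
      · right
        rw [sub_eq_zero.1 h] at hk
        refine proportional hw ?_
        by_contra hcon
        exact hA m (scalar_of_two_eigen M hMw hk hcon)
    · rintro (⟨k, rfl⟩ | ⟨k, rfl⟩)
      · exact ⟨l, by rw [mulVec_smul, hMv, smul_comm]⟩
      · exact ⟨m, by rw [mulVec_smul, hMw, smul_comm]⟩

end matrices

section pgl

open scoped LinearAlgebra.Projectivization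

variable {K L : Type*} [Field K] [Field L]

lemma center_scalar (i : K →+* L) {A : GL (Fin 2) K} (hA : A ∈ Subgroup.center (GL (Fin 2) K)) :
    ∃ c : L, c ≠ 0 ∧ (GeneralLinearGroup.map i A : Matrix (Fin 2) (Fin 2) L) = c • 1 := by
  rw [GeneralLinearGroup.mem_center_iff_val_mem_range_scalar] at hA
  obtain ⟨a, ha⟩ := hA
  have h1 : (GeneralLinearGroup.map i A : Matrix (Fin 2) (Fin 2) L) = (i a) • 1 := by
    ext j k
    rw [GeneralLinearGroup.map_apply, ← ha]
    fin_cases j <;> fin_cases k <;> simp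
  refine ⟨i a, ?_, h1⟩
  intro h0
  have hu := ((GeneralLinearGroup.map i A).isUnit.map (detMonoidHom)).ne_zero
  apply hu
  rw [h1, h0]
  simp

lemma mem_center_of_scalar (i : K →+* L) {A : GL (Fin 2) K} {l : L}
    (h : (GeneralLinearGroup.map i A : Matrix (Fin 2) (Fin 2) L) = l • 1) :
    A ∈ Subgroup.center (GL (Fin 2) K) := by
  rw [GeneralLinearGroup.mem_center_iff_val_mem_range_scalar]
  have e : ∀ j k, i (A j k) = (l • (1 : Matrix (Fin 2) (Fin 2) L)) j k := by
    intro j k; rw [← h, GeneralLinearGroup.map_apply]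
  have e00 := e 0 0
  have e01 := e 0 1
  have e10 := e 1 0
  have e11 := e 1 1
  simp at e00 e01 e10 e11
  refine ⟨A 0 0, ?_⟩
  have : A 0 0 = A 1 1 := i.injective (e00.trans e11.symm)
  ext j k
  fin_cases j <;> fin_cases k <;> simp [e01, e10, this]

/-- `PGL(2,K)` acts on the projective line over any extension field `L`. -/
noncomputable def pglPerm (i : K →+* L) : PGL2 K →* Equiv.Perm (ℙ L (Fin 2 → L)) :=
  QuotientGroup.lift _ ((MulAction.toPermHom (GL (Fin 2) L) (ℙ L (Fin 2 → L))).comp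
    (GeneralLinearGroup.map i)) (by
      intro A hA
      obtain ⟨c, hc0, hc⟩ := center_scalar i hA
      ext x
      induction x using Projectivization.ind with | _ u hu =>
      change GeneralLinearGroup.map i A • Projectivization.mk L u hu = Projectivization.mk L u hu
      rw [Projectivization.smul_mk, Projectivization.mk_eq_mk_iff']
      refine ⟨c, ?_⟩
      change c • u = (GeneralLinearGroup.map i A : Matrix (Fin 2) (Fin 2) L) *ᵥ u
      rw [hc, smul_mulVec, one_mulVec])

lemma pglPerm_mk (i : K →+* L) (A : GL (Fin 2) K) (x : ℙ L (Fin 2 → L)) :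
    pglPerm i (A : PGL2 K) x = GeneralLinearGroup.map i A • x := rfl

lemma char_well_def (i : K →+* L) {A B : GL (Fin 2) K} (hAB : (A : PGL2 K) = B) {v : Fin 2 → L} (hv : v ≠ 0)
    {a b : L} 
    (hA : (GeneralLinearGroup.map i A : Matrix (Fin 2) (Fin 2) L) *ᵥ v = a • v)
    (hB : (GeneralLinearGroup.map i B : Matrix (Fin 2) (Fin 2) L) *ᵥ v = b • v) :
    (GeneralLinearGroup.map i A : Matrix (Fin 2) (Fin 2) L).det / a ^ 2 =
      (GeneralLinearGroup.map i B : Matrix (Fin 2) (Fin 2) L).det / b ^ 2 := by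
  rw [QuotientGroup.eq] at hAB
  obtain ⟨c, hc0, hc⟩ := center_scalar i hAB
  have h1 : (GeneralLinearGroup.map i B : Matrix (Fin 2) (Fin 2) L) =
      c • (GeneralLinearGroup.map i A : Matrix (Fin 2) (Fin 2) L) := by
    have : B = A * (A⁻¹ * B) := by group
    rw [this, map_mul, Units.val_mul, hc]
    simp
  rw [h1] at hB ⊢
  rw [smul_mulVec, hA, smul_smul] at hB
  have hb : b = c * a := by
    have : (c * a - b) • v = 0 := by rw [sub_smul, hB, sub_self]
    exact (sub_eq_zero.1 ((smul_eq_zero.1 this).resolve_right hv)).symm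
  rw [hb, det_smul, Fintype.card_fin, mul_pow]
  rw [mul_div_mul_left _ _ (pow_ne_zero 2 hc0)]

theorem classification_of_embed (i : K →+* L) [CharZero L] [IsAlgClosed L] (G : Subgroup (PGL2 K)) [Finite G] :
    (∃ m : ℕ, 1 ≤ m ∧ Nonempty (G ≃* Multiplicative (ZMod m))) ∨
    (∃ n : ℕ, 1 ≤ n ∧ Nonempty (G ≃* DihedralGroup n)) ∨
    Nonempty (G ≃* alternatingGroup (Fin 4)) ∨
    Nonempty (G ≃* Equiv.Perm (Fin 4)) ∨
    Nonempty (G ≃* alternatingGroup (Fin 5)) := by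
  let act : MulAction G (ℙ L (Fin 2 → L)) :=
    MulAction.compHom _ ((pglPerm i).comp G.subtype)
  have hact : ∀ (g : G) (A : GL (Fin 2) K), (A : PGL2 K) = g → ∀ x : ℙ L (Fin 2 → L),
      g • x = GeneralLinearGroup.map i A • x := by
    intro g A hA x
    change pglPerm i (g : PGL2 K) x = _
    rw [← hA, pglPerm_mk]
  have hpow : ∀ (g : G) (A : GL (Fin 2) K), (A : PGL2 K) = g →
      ∃ c : L, (GeneralLinearGroup.map i A : Matrix (Fin 2) (Fin 2) L) ^ (Nat.card G) = c • 1 := by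
    intro g A hA
    have h1 : g ^ Nat.card G = 1 := pow_card_eq_one'
    have h3 : ((A ^ Nat.card G : GL (Fin 2) K) : PGL2 K) = 1 := by
      rw [QuotientGroup.mk_pow, hA, ← Subgroup.coe_pow, h1]; rfl
    rw [QuotientGroup.eq_one_iff] at h3
    obtain ⟨c, -, hc⟩ := center_scalar i h3
    refine ⟨c, ?_⟩
    rw [← hc, map_pow, Units.val_pow_eq_pow_val]
  have hscal : ∀ (g : G) (A : GL (Fin 2) K), (A : PGL2 K) = g → ∀ l : L,
      (GeneralLinearGroup.map i A : Matrix (Fin 2) (Fin 2) L) = l • 1 → g = 1 := by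
    intro g A hA l hl
    have := mem_center_of_scalar i hl
    rw [← QuotientGroup.eq_one_iff, hA] at this
    exact Subtype.ext this
  have hcard0 : Nat.card G ≠ 0 := Nat.card_pos.ne'
  refine abstract_classification' (G := G) (X := ℙ L (Fin 2 → L)) ?_ ?_
  · intro g hg
    obtain ⟨A, hA⟩ := QuotientGroup.mk_surjective (g : PGL2 K)
    obtain ⟨c, hc⟩ := hpow g A hA
    refine Eq.trans ?_ (two_fixed (GeneralLinearGroup.map i A)
      (fun l hl => hg (hscal g A hA l hl)) hcard0 hc)
    congr 1
    ext x
    rw [mem_fixedBy, mem_fixedBy, hact g A hA]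
  · intro x
    induction x using Projectivization.ind with | _ v hv =>
    have hrep : ∀ g : stabilizer G (Projectivization.mk L v hv), ∃ (A : GL (Fin 2) K) (l : L),
        (A : PGL2 K) = (g : G) ∧
        (GeneralLinearGroup.map i A : Matrix (Fin 2) (Fin 2) L) *ᵥ v = l • v := by
      rintro ⟨g, hg⟩
      obtain ⟨A, hA⟩ := QuotientGroup.mk_surjective (g : PGL2 K)
      rw [mem_stabilizer_iff, hact g A hA, Projectivization.smul_mk,
        Projectivization.mk_eq_mk_iff'] at hg
      obtain ⟨l, hl⟩ := hg
      exact ⟨A, l, hA, hl.symm⟩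
    choose A l hA hl using hrep
    have hl0 : ∀ g, l g ≠ 0 := by
      intro g h0
      have hu : (GeneralLinearGroup.map i (A g) : Matrix (Fin 2) (Fin 2) L).det ≠ 0 :=
        ((GeneralLinearGroup.map i (A g)).isUnit.map (detMonoidHom)).ne_zero
      exact hu (exists_mulVec_eq_zero_iff.1 ⟨v, hv, by rw [hl, h0, zero_smul]⟩)
    let f : stabilizer G (Projectivization.mk L v hv) →* L :=
      { toFun := fun g =>
          (GeneralLinearGroup.map i (A g) : Matrix (Fin 2) (Fin 2) L).det / (l g) ^ 2
        map_one' := by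
          rw [char_well_def i (A := A 1) (B := 1) (b := 1) ((hA 1).trans rfl) hv (hl 1)
            (by simp)]
          simp
        map_mul' := by
          intro g h
          rw [char_well_def i (A := A (g * h)) (B := A g * A h) (b := l g * l h) ?_ hv (hl _) ?_]
          · rw [map_mul, Units.val_mul, det_mul, mul_pow, mul_div_mul_comm]
          · rw [hA, QuotientGroup.mk_mul, hA, hA]; rfl
          · rw [map_mul, Units.val_mul, ← mulVec_mulVec, hl, mulVec_smul, hl, smul_smul,
              mul_comm] }
    refine isCyclic_of_injective_ringHom f ?_
    rw [injective_iff_map_eq_one]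
    intro g hg
    have hg' : (GeneralLinearGroup.map i (A g) : Matrix (Fin 2) (Fin 2) L).det / (l g) ^ 2 = 1 := hg
    rw [div_eq_one_iff_eq (pow_ne_zero 2 (hl0 g))] at hg'
    obtain ⟨c, hc⟩ := hpow g (A g) (hA g)
    have := scalar_of_eigen_det _ (hl0 g) hv (hl g) hg' hcard0 hc
    exact Subtype.ext (hscal g (A g) (hA g) _ this)

end pgl

end FinPGL

/-- Let `p` be a prime and `K` a finite extension of `ℚ_p`.  Every finite subgroup of
`PGL(2,K)` is isomorphic, as an abstract group, to a cyclic group of order `m ≥ 1`, a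
dihedral group `D_n` of order `2n` with `n ≥ 1`, the alternating group `A₄`, the symmetric
group `S₄`, or the alternating group `A₅`. -/
theorem finite_subgroup_pgl2_classification (p : ℕ) [Fact p.Prime]
    (K : Type*) [Field K] [Algebra ℚ_[p] K] [FiniteDimensional ℚ_[p] K]
    (G : Subgroup (PGL2 K)) [Finite G] :
    (∃ m : ℕ, 1 ≤ m ∧ Nonempty (G ≃* Multiplicative (ZMod m))) ∨
    (∃ n : ℕ, 1 ≤ n ∧ Nonempty (G ≃* DihedralGroup n)) ∨
    Nonempty (G ≃* alternatingGroup (Fin 4)) ∨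
    Nonempty (G ≃* Equiv.Perm (Fin 4)) ∨
    Nonempty (G ≃* alternatingGroup (Fin 5)) := by
  have : CharZero K := charZero_of_injective_algebraMap (algebraMap ℚ_[p] K).injective
  have : CharZero (AlgebraicClosure K) :=
    charZero_of_injective_algebraMap (algebraMap K (AlgebraicClosure K)).injective
  exact FinPGL.classification_of_embed (algebraMap K (AlgebraicClosure K)) G
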